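/- Let 2 ≤ p < ∞. There exists a constant C (possibly depending on p) such that for all positive integers n, m, the identity map on ℝ^{m×n}, viewed as a map from (ℝ^{m×n}, ‖·‖_∧) to (ℝ^{m×n}, ‖·‖_∨), satisfies E_{2,1}(id) := Σ_{k≥1} e_k(id)/√k ≤ C √(1 + n + m) · (1 + ln n + ln m)^{3/2}, where ‖M‖_∧ := inf{Σ_i ‖x_i‖_∞ ‖y_i‖_p : M = Σ_i y_i x_iᵀ, x_i ∈ ℝ^n, y_i ∈ ℝ^m} is the projective tensor norm on ℓ∞^n ⊗ ℓ_p^m and ‖M‖_∨ := max_{1≤j≤n} ‖M e_j‖_p is the injective tensor norm (the operator norm of M : ℓ1^n → ℓ_p^m). -/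

import Mathlib

open Real Set Matrix
open scoped Pointwise

/-- Packing number `M(D,E)`. -/
noncomputable def packingNumber {V : Type*} [AddCommGroup V] (D E : Set V) : ℕ∞ :=
  sSup {l : ℕ∞ | ∃ (l' : ℕ) (y : Fin l' → V), l = (l' : ℕ∞) ∧ (∀ i, y i ∈ D) ∧
    ∀ i j, i ≠ j → y i - y j ∉ E}

/-- Dyadic entropy numbers of the identity, between the norms with unit balls `D` and `E`. -/
noncomputable def entropyNumberBalls {V : Type*} [AddCommGroup V] [Module ℝ V]
    (D E : Set V) (k : ℕ) : ℝ :=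
  sInf {ε : ℝ | 0 < ε ∧ packingNumber D (ε • E) ≤ (2^(k-1) : ℕ∞)}

/-- `E_{2,1} = Σ_{k ≥ 1} e_k/√k` -/
noncomputable def E21balls {V : Type*} [AddCommGroup V] [Module ℝ V] (D E : Set V) : ℝ :=
  ∑' k : ℕ, entropyNumberBalls D E (k+1) / Real.sqrt (k+1)

/-- sup-norm of a vector -/
noncomputable def supNorm {n : ℕ} (x : Fin n → ℝ) : ℝ := ⨆ j, |x j|

/-- `p`-norm of a vector -/
noncomputable def pNorm {m : ℕ} (p : ℝ) (y : Fin m → ℝ) : ℝ :=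
  (∑ i, |y i| ^ p) ^ (1/p)

/-- projective tensor norm on `ℓ∞^n ⊗ ℓ_p^m`:
`‖M‖_∧ = inf {Σ_i ‖x_i‖_∞ ‖y_i‖_p : M = Σ_i y_i x_iᵀ}` -/
noncomputable def projNormInfP {m n : ℕ} (p : ℝ) (M : Matrix (Fin m) (Fin n) ℝ) : ℝ :=
  sInf {c | ∃ (s : ℕ) (x : Fin s → (Fin n → ℝ)) (y : Fin s → (Fin m → ℝ)),
    (∀ a b, M a b = ∑ i, y i a * x i b) ∧ c = ∑ i, supNorm (x i) * pNorm p (y i)}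

/-- injective tensor norm on `ℓ∞^n ⊗ ℓ_p^m`: `‖M‖_∨ = max_j ‖M e_j‖_p`,
the operator norm of `M : ℓ1^n → ℓ_p^m` -/
noncomputable def injNormInfP {m n : ℕ} (p : ℝ) (M : Matrix (Fin m) (Fin n) ℝ) : ℝ :=
  ⨆ j : Fin n, pNorm p (fun i => M i j)

/-- The sign `±1` encoded by a Boolean. -/
def boolSign (b : Bool) : ℝ := if b then 1 else -1

lemma sum_pi_prod_eq_one {I : Type*} [Fintype I] (w : I → ℝ) (hw : ∑ i, w i = 1) (N : ℕ) :
    ∑ τ : Fin N → I, ∏ t, w (τ t) = 1 := by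
  classical
  have h := Finset.prod_univ_sum (fun _ : Fin N => (Finset.univ : Finset I)) (fun _ i => w i)
  rw [Fintype.piFinset_univ] at h
  rw [← h]; simp [hw]

lemma sum_pi_prod_smul_eval {V I : Type*} [AddCommGroup V] [Module ℝ V] [Fintype I]
    (w : I → ℝ) (hw : ∑ i, w i = 1) (f : I → V) {N : ℕ} (t : Fin N) :
    ∑ τ : Fin N → I, (∏ s, w (τ s)) • f (τ t) = ∑ i, w i • f i := by
  classical
  rw [← Finset.sum_fiberwise (s := Finset.univ) (g := fun τ : Fin N → I => τ t)]
  refine Finset.sum_congr rfl fun i _ => ?_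
  have h1 : ∑ τ : Fin N → I with τ t = i, (∏ s, w (τ s)) • f (τ t)
      = (∑ τ : Fin N → I with τ t = i, (∏ s, w (τ s))) • f i := by
    rw [Finset.sum_smul]
    refine Finset.sum_congr rfl fun τ hτ => ?_
    rw [(Finset.mem_filter.1 hτ).2]
  rw [h1]
  congr 1
  have h := Finset.prod_univ_sum
    (fun s : Fin N => if s = t then ({i} : Finset I) else Finset.univ) (fun _ i => w i)
  have h2 : Fintype.piFinset (fun s : Fin N => if s = t then ({i} : Finset I) else Finset.univ)
      = Finset.univ.filter (fun τ : Fin N → I => τ t = i) := by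
    ext τ
    simp only [Fintype.mem_piFinset, Finset.mem_filter, Finset.mem_univ, true_and]
    constructor
    · intro h; simpa using h t
    · intro h s; by_cases hs : s = t
      · subst hs; simp [h]
      · simp [hs]
  rw [h2] at h
  rw [← h, Finset.prod_eq_single t]
  · simp
  · intro s _ hs; simp [hs, hw]
  · simp

/-- Symmetrization: if the sign averages of differences of atoms are at most `B` in `ν`, then any
convex combination of the atoms is approximated by an empirical mean. -/
lemma exists_empirical_mean {V I : Type*} [AddCommGroup V] [Module ℝ V] [Fintype I]
    {ν : V → ℝ} (hν : ConvexOn ℝ univ ν) {w : I → ℝ} (hw0 : ∀ i, 0 ≤ w i) (hw : ∑ i, w i = 1)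
    (f : I → V) (N : ℕ) {B : ℝ}
    (hB : ∀ g : Fin N → I × I, ∑ ε : Fin N → Bool,
      ν (∑ t, boolSign (ε t) • (f (g t).1 - f (g t).2)) ≤ 2 ^ N * B) :
    ∃ τ : Fin N → I, ν (∑ t, f (τ t) - (N : ℝ) • ∑ i, w i • f i) ≤ B := by
  classical
  by_contra! hcon
  set W : (Fin N → I) → ℝ := fun τ => ∏ t, w (τ t) with hW
  have hW0 : ∀ τ, 0 ≤ W τ := fun τ => Finset.prod_nonneg fun t _ => hw0 _
  have hW1 : ∑ τ, W τ = 1 := sum_pi_prod_eq_one w hw N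
  have hmean : ∑ τ : Fin N → I, W τ • ∑ t, f (τ t) = (N : ℝ) • ∑ i, w i • f i := by
    simp_rw [Finset.smul_sum]
    rw [Finset.sum_comm]
    simp_rw [hW, sum_pi_prod_smul_eval w hw f]
    simp [Finset.smul_sum, ← Nat.cast_smul_eq_nsmul ℝ]
  have hstep : ∀ τ : Fin N → I, ν (∑ t, f (τ t) - (N : ℝ) • ∑ i, w i • f i) ≤
      ∑ τ', W τ' * ν (∑ t, (f (τ t) - f (τ' t))) := by
    intro τ
    have := hν.map_sum_le (t := Finset.univ) (w := W)
      (p := fun τ' => ∑ t, (f (τ t) - f (τ' t))) (fun i _ => hW0 i) hW1 (fun _ _ => mem_univ _)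
    have hsum : ∑ τ' : Fin N → I, W τ' • ∑ t, (f (τ t) - f (τ' t))
        = ∑ t, f (τ t) - (N : ℝ) • ∑ i, w i • f i := by
      simp only [Finset.sum_sub_distrib, smul_sub]
      rw [← Finset.sum_smul, hW1, one_smul, hmean]
    rwa [hsum] at this
  set W2 : (Fin N → I × I) → ℝ := fun g => ∏ t, (w (g t).1 * w (g t).2) with hW2
  have hW20 : ∀ g, 0 ≤ W2 g := fun g =>
    Finset.prod_nonneg fun t _ => mul_nonneg (hw0 _) (hw0 _)
  have hW21 : ∑ g, W2 g = 1 :=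
    sum_pi_prod_eq_one (fun i : I × I => w i.1 * w i.2)
      (by rw [Fintype.sum_prod_type, ← Finset.sum_mul_sum, hw, one_mul]) N
  set Q : ℝ := ∑ g, W2 g * ν (∑ t, (f (g t).1 - f (g t).2)) with hQ
  have hQ1 : ∑ τ, W τ * ∑ τ', W τ' * ν (∑ t, (f (τ t) - f (τ' t))) = Q := by
    rw [hQ, Fintype.sum_equiv (Equiv.arrowProdEquivProdArrow (Fin N) (fun _ => I) (fun _ => I)) _
      (fun x => W x.1 * (W x.2 * ν (∑ t, (f (x.1 t) - f (x.2 t)))))]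
    · rw [Fintype.sum_prod_type]
      simp_rw [Finset.mul_sum]
    · intro g
      simp only [hW2, hW, Finset.prod_mul_distrib, mul_assoc]
      rfl
  have hBQ : B < Q := by
    rw [← hQ1]
    have h1 : B = ∑ τ, W τ * B := by rw [← Finset.sum_mul, hW1, one_mul]
    obtain ⟨τ₀, hτ₀⟩ : ∃ τ, 0 < W τ := by
      by_contra! h
      have : ∑ τ, W τ ≤ 0 := Finset.sum_nonpos fun τ _ => h τ
      linarith
    rw [h1]
    refine Finset.sum_lt_sum (fun τ _ => ?_) ⟨τ₀, Finset.mem_univ _, ?_⟩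
    · exact mul_le_mul_of_nonneg_left ((hcon τ).le.trans (hstep τ)) (hW0 τ)
    · exact mul_lt_mul_of_pos_left ((hcon _).trans_le (hstep _)) hτ₀
  have hsym : ∀ ε : Fin N → Bool,
      ∑ g, W2 g * ν (∑ t, boolSign (ε t) • (f (g t).1 - f (g t).2)) = Q := by
    intro ε
    have hinv : Function.Involutive
        (fun (g : Fin N → I × I) t => if ε t then g t else (g t).swap) := by
      intro g; funext t; by_cases h : ε t <;> simp [h]
    rw [hQ]
    refine Fintype.sum_equiv hinv.toPerm _ _ fun g => ?_
    simp only [Function.Involutive.coe_toPerm, hW2]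
    congr 1
    · refine Finset.prod_congr rfl fun t _ => ?_
      by_cases h : ε t <;> simp [h, mul_comm]
    · congr 1
      refine Finset.sum_congr rfl fun t _ => ?_
      by_cases h : ε t <;> simp [h, boolSign]
  have h2 : (2 : ℝ) ^ N * Q ≤ 2 ^ N * B := by
    calc (2 : ℝ) ^ N * Q = ∑ ε : Fin N → Bool,
          ∑ g, W2 g * ν (∑ t, boolSign (ε t) • (f (g t).1 - f (g t).2)) := by
          simp_rw [hsym]; simp
      _ = ∑ g, W2 g * ∑ ε : Fin N → Bool,
            ν (∑ t, boolSign (ε t) • (f (g t).1 - f (g t).2)) := by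
          rw [Finset.sum_comm]; simp_rw [Finset.mul_sum]
      _ ≤ ∑ g, W2 g * (2 ^ N * B) :=
          Finset.sum_le_sum fun g _ => mul_le_mul_of_nonneg_left (hB g) (hW20 g)
      _ = 2 ^ N * B := by rw [← Finset.sum_mul, hW21, one_mul]
  exact absurd (le_of_mul_le_mul_left h2 (by positivity)) (not_le.2 hBQ)

lemma sum_exp_signed_sum_le {N : ℕ} (a : Fin N → ℝ) :
    ∑ ε : Fin N → Bool, exp (∑ t, boolSign (ε t) * a t) ≤ 2 ^ N * exp ((∑ t, a t ^ 2) / 2) := by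
  have h : ∑ ε : Fin N → Bool, exp (∑ t, boolSign (ε t) * a t) = ∏ t, (2 * cosh (a t)) := by
    simp_rw [Real.exp_sum]
    rw [← Fintype.prod_sum (fun t b => exp (boolSign b * a t))]
    refine Finset.prod_congr rfl fun t _ => ?_
    rw [Real.cosh_eq]
    simp [boolSign]
    ring
  rw [h, Finset.prod_mul_distrib, Finset.sum_div, Real.exp_sum]
  simp only [Finset.prod_const, Finset.card_univ, Fintype.card_fin]
  gcongr with t
  exact Real.cosh_le_exp_half_sq _

/-- Khintchine's inequality for signed sums whose coefficients have square sum at most `1`. -/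
lemma khintchine_of_sum_sq_le_one {N : ℕ} (a : Fin N → ℝ) (ha : ∑ t, a t ^ 2 ≤ 1) {q : ℕ}
    (hq : 0 < q) :
    ∑ ε : Fin N → Bool, |∑ t, boolSign (ε t) * a t| ^ q ≤ 2 ^ N * (2 * √(exp 1 * q) ^ q) := by
  have hq' : (0 : ℝ) < q := by exact_mod_cast hq
  set l : ℝ := √q with hl
  have hl0 : 0 < l := Real.sqrt_pos.2 hq'
  have hl2 : l ^ 2 = q := Real.sq_sqrt hq'.le
  have hpt : ∀ s : ℝ, |s| ^ q ≤ l ^ q * (exp (l * s) + exp (-(l * s))) := by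
    intro s
    have h1 := Real.pow_div_factorial_le_exp (l * |s|) (by positivity) q
    have hf : (q.factorial : ℝ) ≤ l ^ q * l ^ q := by
      rw [← mul_pow, ← sq, hl2]; exact_mod_cast Nat.factorial_le_pow q
    have h2 : exp (l * |s|) ≤ exp (l * s) + exp (-(l * s)) := by
      rcases abs_choice s with h | h <;> rw [h]
      · linarith [exp_pos (-(l * s))]
      · rw [mul_neg]; linarith [exp_pos (l * s)]
    rw [div_le_iff₀ (by positivity), mul_pow] at h1
    have h3 : l ^ q * |s| ^ q ≤ l ^ q * (l ^ q * (exp (l * s) + exp (-(l * s)))) := by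
      calc l ^ q * |s| ^ q ≤ exp (l * |s|) * q.factorial := h1
        _ ≤ (exp (l * s) + exp (-(l * s))) * (l ^ q * l ^ q) := by gcongr
        _ = _ := by ring
    exact le_of_mul_le_mul_left h3 (by positivity)
  have hE : ∀ c : ℝ, c ^ 2 = q → ∑ ε : Fin N → Bool, exp (c * ∑ t, boolSign (ε t) * a t)
      ≤ 2 ^ N * exp (q / 2) := by
    intro c hc
    have h := sum_exp_signed_sum_le (fun t => c * a t)
    have h4 : ∑ t, (c * a t) ^ 2 ≤ q := by
      simp_rw [mul_pow]; rw [← Finset.mul_sum, hc]; nlinarith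
    calc _ = ∑ ε : Fin N → Bool, exp (∑ t, boolSign (ε t) * (c * a t)) := by
          simp_rw [Finset.mul_sum]
          refine Finset.sum_congr rfl fun ε _ => ?_
          congr 1; refine Finset.sum_congr rfl fun t _ => by ring
      _ ≤ _ := h
      _ ≤ _ := by gcongr
  have hexp : √(exp 1 * q) ^ q = l ^ q * exp (q / 2) := by
    rw [Real.sqrt_mul (exp_pos _).le, mul_pow, mul_comm, ← Real.exp_half, ← Real.exp_nat_mul]
    congr 2; ring
  calc _ ≤ ∑ ε : Fin N → Bool, l ^ q * (exp (l * ∑ t, boolSign (ε t) * a t)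
          + exp (-l * ∑ t, boolSign (ε t) * a t)) :=
        Finset.sum_le_sum fun ε _ => by simpa only [neg_mul] using hpt _
    _ = l ^ q * (∑ ε : Fin N → Bool, exp (l * ∑ t, boolSign (ε t) * a t)
          + ∑ ε : Fin N → Bool, exp (-l * ∑ t, boolSign (ε t) * a t)) := by
        rw [← Finset.mul_sum, Finset.sum_add_distrib]
    _ ≤ l ^ q * (2 ^ N * exp (q / 2) + 2 ^ N * exp (q / 2)) := by
        gcongr
        · exact hE l hl2
        · exact hE (-l) (by rw [neg_sq, hl2])
    _ = _ := by rw [hexp]; ring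

lemma sum_sq_rpow_le {N : ℕ} {p : ℝ} (hp : 2 ≤ p) (a : Fin N → ℝ) :
    √(∑ t, a t ^ 2) ^ p ≤ (N : ℝ) ^ (p / 2 - 1) * ∑ t, |a t| ^ p := by
  have h := Real.rpow_sum_le_const_mul_sum_rpow Finset.univ (fun t => a t ^ 2) (p := p / 2)
    (by linarith)
  simp only [abs_pow, sq_abs, Finset.card_univ, Fintype.card_fin] at h
  rw [Real.sqrt_eq_rpow, ← Real.rpow_mul (Finset.sum_nonneg fun t _ => sq_nonneg _)]
  have e : (1 : ℝ) / 2 * p = p / 2 := by ring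
  rw [e]
  refine h.trans_eq ?_
  congr 1
  refine Finset.sum_congr rfl fun t _ => ?_
  rw [← sq_abs, ← Real.rpow_natCast_mul (abs_nonneg _)]
  congr 1; push_cast; ring

lemma pNorm_nonneg {m : ℕ} (p : ℝ) (y : Fin m → ℝ) : 0 ≤ pNorm p y :=
  Real.rpow_nonneg (Finset.sum_nonneg fun _ _ => Real.rpow_nonneg (abs_nonneg _) _) _

lemma pNorm_rpow {m : ℕ} {p : ℝ} (hp : 0 < p) (y : Fin m → ℝ) :
    pNorm p y ^ p = ∑ i, |y i| ^ p := by
  rw [pNorm, ← Real.rpow_mul (Finset.sum_nonneg fun _ _ => Real.rpow_nonneg (abs_nonneg _) _),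
    one_div, inv_mul_cancel₀ hp.ne', Real.rpow_one]

lemma sum_pNorm_signed_sum_pow_le {m N q : ℕ} {p b : ℝ} (hp : 2 ≤ p) (hb : 0 ≤ b) (hq : p ≤ q)
    (h : Fin N → Fin m → ℝ) (hh : ∀ t, pNorm p (h t) ≤ b) :
    ∑ ε : Fin N → Bool, pNorm p (fun i => ∑ t, boolSign (ε t) * h t i) ^ q
      ≤ 2 ^ N * (2 * (√(exp 1 * q) * (√N * b)) ^ q) := by
  have hp0 : 0 < p := by linarith
  have hq0 : (0 : ℝ) < q := by linarith
  have hqn : 0 < q := by exact_mod_cast hq0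
  set σ : Fin m → ℝ := fun i => √(∑ t, h t i ^ 2) with hσ
  have hσ0 : ∀ i, 0 ≤ σ i := fun i => Real.sqrt_nonneg _
  have hσ2 : ∀ i, σ i ^ 2 = ∑ t, h t i ^ 2 := fun i =>
    Real.sq_sqrt (Finset.sum_nonneg fun t _ => sq_nonneg _)
  set W : ℝ := ∑ i, σ i ^ p with hW
  have hW0 : 0 ≤ W := Finset.sum_nonneg fun i _ => Real.rpow_nonneg (hσ0 i) _
  have hWle : W ≤ (√N * b) ^ p := by
    calc W ≤ ∑ i, (N : ℝ) ^ (p / 2 - 1) * ∑ t, |h t i| ^ p :=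
          Finset.sum_le_sum fun i _ => sum_sq_rpow_le hp _
      _ = (N : ℝ) ^ (p / 2 - 1) * ∑ t, pNorm p (h t) ^ p := by
          rw [← Finset.mul_sum, Finset.sum_comm]; simp_rw [pNorm_rpow hp0]
      _ ≤ (N : ℝ) ^ (p / 2 - 1) * ∑ t : Fin N, b ^ p := by
          gcongr with t
          · exact pNorm_nonneg _ _
          · exact hh t
      _ = (√N * b) ^ p := by
          rw [Real.mul_rpow (Real.sqrt_nonneg _) hb, Real.sqrt_eq_rpow,
            ← Real.rpow_mul (Nat.cast_nonneg _)]
          simp only [Finset.sum_const, Finset.card_univ, Fintype.card_fin, nsmul_eq_mul]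
          rw [← mul_assoc]
          congr 1
          rcases Nat.eq_zero_or_pos N with hN | hN
          · subst hN
            rw [Nat.cast_zero, mul_zero, Real.zero_rpow (by positivity)]
          · have hN' : (0 : ℝ) < N := by exact_mod_cast hN
            rw [← Real.rpow_add_one hN'.ne']
            congr 1; ring
  set a : Fin m → Fin N → ℝ := fun i t => h t i / σ i with ha
  have hha : ∀ i t, h t i = σ i * a i t := by
    intro i t
    by_cases h0 : σ i = 0
    · have h1 := hσ2 i
      rw [h0, zero_pow two_ne_zero, eq_comm,
        Finset.sum_eq_zero_iff_of_nonneg (fun t _ => sq_nonneg _)] at h1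
      rw [h0, zero_mul]
      simpa using h1 t (Finset.mem_univ _)
    · rw [ha]; field_simp
  have hasum : ∀ i, ∑ t, a i t ^ 2 ≤ 1 := by
    intro i
    simp only [ha, div_pow]
    rw [← Finset.sum_div, ← hσ2]
    exact div_self_le_one _
  have hpt : ∀ ε : Fin N → Bool, pNorm p (fun i => ∑ t, boolSign (ε t) * h t i) ^ q
      ≤ W ^ (q / p - 1) * ∑ i, σ i ^ p * |∑ t, boolSign (ε t) * a i t| ^ q := by
    intro ε
    set u : Fin m → ℝ := fun i => |∑ t, boolSign (ε t) * a i t| with hu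
    have hu0 : ∀ i, 0 ≤ u i := fun i => abs_nonneg _
    have hS : ∀ i, |∑ t, boolSign (ε t) * h t i| = σ i * u i := by
      intro i
      rw [hu, ← abs_of_nonneg (hσ0 i), ← abs_mul, Finset.mul_sum]
      congr 1; refine Finset.sum_congr rfl fun t _ => ?_
      rw [hha i t]; ring
    have h1 := Real.inner_le_weight_mul_Lp_of_nonneg Finset.univ (p := q / p)
      (by rw [le_div_iff₀ hp0]; linarith) (fun i => σ i ^ p) (fun i => u i ^ p)
      (fun i => Real.rpow_nonneg (hσ0 i) _) (fun i => Real.rpow_nonneg (hu0 i) _)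
    have h2 : ∀ i, (u i ^ p) ^ ((q : ℝ) / p) = u i ^ q := by
      intro i
      rw [← Real.rpow_mul (hu0 i), mul_div_cancel₀ _ hp0.ne', Real.rpow_natCast]
    simp_rw [h2] at h1
    have h3 : ∑ i, σ i ^ p * u i ^ p = pNorm p (fun i => ∑ t, boolSign (ε t) * h t i) ^ p := by
      rw [pNorm_rpow hp0]
      refine Finset.sum_congr rfl fun i _ => ?_
      rw [hS, Real.mul_rpow (hσ0 i) (hu0 i)]
    rw [h3] at h1
    have hX : 0 ≤ ∑ i, σ i ^ p * u i ^ q := Finset.sum_nonneg fun i _ =>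
      mul_nonneg (Real.rpow_nonneg (hσ0 i) _) (pow_nonneg (hu0 i) _)
    have hn := pNorm_nonneg p (fun i => ∑ t, boolSign (ε t) * h t i)
    have h4 := Real.rpow_le_rpow (Real.rpow_nonneg hn _) h1 (z := q / p) (by positivity)
    rw [← Real.rpow_mul hn, mul_div_cancel₀ _ hp0.ne', Real.rpow_natCast,
      Real.mul_rpow (Real.rpow_nonneg hW0 _) (Real.rpow_nonneg hX _), ← Real.rpow_mul hW0,
      ← Real.rpow_mul hX, inv_mul_cancel₀ (by positivity), Real.rpow_one] at h4
    convert h4 using 3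
    field_simp
  calc _ ≤ ∑ ε : Fin N → Bool,
          W ^ (q / p - 1) * ∑ i, σ i ^ p * |∑ t, boolSign (ε t) * a i t| ^ q :=
        Finset.sum_le_sum fun ε _ => hpt ε
    _ = W ^ (q / p - 1) * ∑ i, σ i ^ p *
          ∑ ε : Fin N → Bool, |∑ t, boolSign (ε t) * a i t| ^ q := by
        rw [← Finset.mul_sum, Finset.sum_comm]; simp_rw [Finset.mul_sum]
    _ ≤ W ^ (q / p - 1) * ∑ i, σ i ^ p * (2 ^ N * (2 * √(exp 1 * q) ^ q)) := by
        gcongr with i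
        exact khintchine_of_sum_sq_le_one _ (hasum i) hqn
    _ = W ^ (q / p - 1 + 1) * (2 ^ N * (2 * √(exp 1 * q) ^ q)) := by
        rw [← Finset.sum_mul, ← hW, ← mul_assoc,
          Real.rpow_add_one' hW0 (by rw [sub_add_cancel]; positivity)]
    _ ≤ ((√N * b) ^ p) ^ (q / p - 1 + 1) * (2 ^ N * (2 * √(exp 1 * q) ^ q)) := by
        gcongr
        rw [sub_add_cancel]; positivity
    _ = _ := by
        rw [sub_add_cancel, ← Real.rpow_mul (by positivity), mul_div_cancel₀ _ hp0.ne',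
          Real.rpow_natCast]
        simp only [mul_pow]; ring

lemma pNorm_add_le {m : ℕ} {p : ℝ} (hp : 1 ≤ p) (y z : Fin m → ℝ) :
    pNorm p (y + z) ≤ pNorm p y + pNorm p z :=
  Real.Lp_add_le Finset.univ y z hp

lemma pNorm_smul {m : ℕ} {p : ℝ} (hp : 0 < p) (c : ℝ) (y : Fin m → ℝ) :
    pNorm p (c • y) = |c| * pNorm p y := by
  have h : ∑ i, |(c • y) i| ^ p = |c| ^ p * ∑ i, |y i| ^ p := by
    rw [Finset.mul_sum]
    refine Finset.sum_congr rfl fun i _ => ?_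
    rw [Pi.smul_apply, smul_eq_mul, abs_mul, Real.mul_rpow (abs_nonneg _) (abs_nonneg _)]
  rw [pNorm, h, Real.mul_rpow (by positivity)
    (Finset.sum_nonneg fun _ _ => Real.rpow_nonneg (abs_nonneg _) _),
    ← Real.rpow_mul (abs_nonneg _), mul_one_div_cancel hp.ne', Real.rpow_one, pNorm]

lemma abs_le_pNorm {m : ℕ} {p : ℝ} (hp : 0 < p) (y : Fin m → ℝ) (i : Fin m) :
    |y i| ≤ pNorm p y := by
  rw [← Real.rpow_le_rpow_iff (abs_nonneg _) (pNorm_nonneg _ _) hp, pNorm_rpow hp]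
  exact Finset.single_le_sum (f := fun i => |y i| ^ p)
    (fun _ _ => Real.rpow_nonneg (abs_nonneg _) _) (Finset.mem_univ i)

lemma pNorm_le_of_abs_le {m : ℕ} {p δ : ℝ} (hp : 0 < p) (hδ : 0 ≤ δ) {y : Fin m → ℝ}
    (hy : ∀ i, |y i| ≤ δ) : pNorm p y ≤ (m : ℝ) ^ (1 / p) * δ := by
  rw [← Real.rpow_le_rpow_iff (pNorm_nonneg _ _) (by positivity) hp, pNorm_rpow hp,
    Real.mul_rpow (by positivity) hδ, ← Real.rpow_mul (by positivity),
    one_div_mul_cancel hp.ne', Real.rpow_one]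
  calc ∑ i, |y i| ^ p ≤ ∑ _i : Fin m, δ ^ p := by
        gcongr with i
        exact hy i
    _ = _ := by simp

lemma injNormInfP_nonneg {m n : ℕ} (p : ℝ) (M : Matrix (Fin m) (Fin n) ℝ) :
    0 ≤ injNormInfP p M :=
  Real.iSup_nonneg fun _ => pNorm_nonneg _ _

lemma pNorm_col_le_injNormInfP {m n : ℕ} (p : ℝ) (M : Matrix (Fin m) (Fin n) ℝ) (j : Fin n) :
    pNorm p (fun i => M i j) ≤ injNormInfP p M :=
  le_ciSup (f := fun j => pNorm p (fun i => M i j)) (Set.finite_range _).bddAbove j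

lemma injNormInfP_le {m n : ℕ} {p c : ℝ} {M : Matrix (Fin m) (Fin n) ℝ} (hc : 0 ≤ c)
    (h : ∀ j, pNorm p (fun i => M i j) ≤ c) : injNormInfP p M ≤ c :=
  Real.iSup_le h hc

lemma injNormInfP_add_le {m n : ℕ} {p : ℝ} (hp : 1 ≤ p) (M M' : Matrix (Fin m) (Fin n) ℝ) :
    injNormInfP p (M + M') ≤ injNormInfP p M + injNormInfP p M' :=
  injNormInfP_le (add_nonneg (injNormInfP_nonneg _ _) (injNormInfP_nonneg _ _)) fun j =>
    (pNorm_add_le hp (fun i => M i j) (fun i => M' i j)).trans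
      (add_le_add (pNorm_col_le_injNormInfP p M j) (pNorm_col_le_injNormInfP p M' j))

lemma injNormInfP_smul {m n : ℕ} {p : ℝ} (hp : 0 < p) (c : ℝ) (M : Matrix (Fin m) (Fin n) ℝ) :
    injNormInfP p (c • M) = |c| * injNormInfP p M := by
  rw [injNormInfP, injNormInfP, Real.mul_iSup_of_nonneg (abs_nonneg c)]
  congr 1
  funext j
  exact pNorm_smul hp c _

lemma injNormInfP_sub_le {m n : ℕ} {p : ℝ} (hp : 1 ≤ p) (M M' : Matrix (Fin m) (Fin n) ℝ) :
    injNormInfP p (M - M') ≤ injNormInfP p M + injNormInfP p M' := by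
  have h := injNormInfP_add_le hp M ((-1 : ℝ) • M')
  rw [injNormInfP_smul (by linarith)] at h
  simpa [sub_eq_add_neg] using h

lemma convexOn_injNormInfP {m n : ℕ} {p : ℝ} (hp : 1 ≤ p) :
    ConvexOn ℝ univ (injNormInfP p : Matrix (Fin m) (Fin n) ℝ → ℝ) := by
  refine ⟨convex_univ, fun M _ M' _ a b ha hb _ => ?_⟩
  refine (injNormInfP_add_le hp _ _).trans_eq ?_
  rw [injNormInfP_smul (by linarith), injNormInfP_smul (by linarith), abs_of_nonneg ha,
    abs_of_nonneg hb, smul_eq_mul, smul_eq_mul]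

lemma injNormInfP_pow_le_sum {m n q : ℕ} {p : ℝ} (hq : q ≠ 0) (M : Matrix (Fin m) (Fin n) ℝ) :
    injNormInfP p M ^ q ≤ ∑ j, pNorm p (fun i => M i j) ^ q := by
  rcases isEmpty_or_nonempty (Fin n) with hn | hn
  · simp [injNormInfP, hq]
  · obtain ⟨j, hj⟩ := exists_eq_ciSup_of_finite (f := fun j => pNorm p (fun i => M i j))
    rw [injNormInfP, ← hj]
    exact Finset.single_le_sum (f := fun j => pNorm p (fun i => M i j) ^ q)
      (fun _ _ => pow_nonneg (pNorm_nonneg _ _) _) (Finset.mem_univ j)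

lemma sum_injNormInfP_signed_sum_le {m n N q : ℕ} {p b : ℝ} (hp : 2 ≤ p) (hb : 0 ≤ b)
    (hq : p ≤ q) (hnq : 2 * (n : ℝ) ≤ exp q) (h : Fin N → Matrix (Fin m) (Fin n) ℝ)
    (hh : ∀ t, injNormInfP p (h t) ≤ b) :
    ∑ ε : Fin N → Bool, injNormInfP p (∑ t, boolSign (ε t) • h t)
      ≤ 2 ^ N * (exp 1 * (√(exp 1 * q) * (√N * b))) := by
  have hq0 : (0 : ℝ) < q := by linarith
  have hqn : q ≠ 0 := by rintro rfl; simp at hq0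
  set R : ℝ := √(exp 1 * q) * (√N * b) with hR
  have hR0 : 0 ≤ R := by positivity
  have hcol : ∀ j, ∑ ε : Fin N → Bool,
      pNorm p (fun i => (∑ t, boolSign (ε t) • h t) i j) ^ q ≤ 2 ^ N * (2 * R ^ q) := by
    intro j
    have := sum_pNorm_signed_sum_pow_le hp hb hq (fun t i => h t i j)
      (fun t => (pNorm_col_le_injNormInfP p (h t) j).trans (hh t))
    simpa only [Matrix.sum_apply, Matrix.smul_apply, smul_eq_mul] using this
  have hsum : ∑ ε : Fin N → Bool, injNormInfP p (∑ t, boolSign (ε t) • h t) ^ q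
      ≤ 2 ^ N * (exp 1 * R) ^ q := by
    calc _ ≤ ∑ ε : Fin N → Bool, ∑ j, pNorm p (fun i => (∑ t, boolSign (ε t) • h t) i j) ^ q :=
          Finset.sum_le_sum fun ε _ => injNormInfP_pow_le_sum hqn _
      _ ≤ ∑ _j : Fin n, 2 ^ N * (2 * R ^ q) := by
          rw [Finset.sum_comm]
          exact Finset.sum_le_sum fun j _ => hcol j
      _ = 2 ^ N * ((2 * n) * R ^ q) := by simp; ring
      _ ≤ 2 ^ N * (exp q * R ^ q) := by gcongr
      _ = 2 ^ N * (exp 1 * R) ^ q := by rw [mul_pow (exp 1) R, ← Real.exp_nat_mul, mul_one]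
  obtain ⟨r, rfl⟩ := Nat.exists_eq_succ_of_ne_zero hqn
  have hJ := pow_sum_div_card_le_sum_pow (s := Finset.univ)
    (f := fun ε : Fin N → Bool => injNormInfP p (∑ t, boolSign (ε t) • h t))
    (fun _ _ => injNormInfP_nonneg _ _) r
  have hJ' := hJ.trans hsum
  simp only [Finset.card_univ, Fintype.card_fun, Fintype.card_bool, Fintype.card_fin,
    Nat.cast_pow, Nat.cast_ofNat] at hJ'
  rw [div_le_iff₀ (by positivity)] at hJ'
  refine le_of_pow_le_pow_left₀ hqn (by positivity) (hJ'.trans_eq ?_)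
  rw [mul_pow (2 ^ N), pow_succ (2 ^ N : ℝ) r]
  ring

lemma sum_Icc_half_pow_natAbs (L : ℕ) :
    ∑ j ∈ Finset.Icc (-(L : ℤ)) L, (1 / 2 : ℝ) ^ j.natAbs = 3 - 2 * (1 / 2) ^ L := by
  induction L with
  | zero => norm_num
  | succ L ih =>
    have h : Finset.Icc (-((L + 1 : ℕ) : ℤ)) ((L + 1 : ℕ) : ℤ)
        = insert (-((L + 1 : ℕ) : ℤ)) (insert ((L + 1 : ℕ) : ℤ) (Finset.Icc (-(L : ℤ)) L)) := by
      ext j; simp only [Finset.mem_Icc, Finset.mem_insert]; omega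
    rw [h, Finset.sum_insert, Finset.sum_insert, ih, Int.natAbs_neg, Int.natAbs_natCast]
    · ring
    · simp only [Finset.mem_Icc]; omega
    · simp only [Finset.mem_Icc, Finset.mem_insert]; omega

lemma card_le_of_sum_natAbs_le {m L : ℕ} (S : Finset (Fin m → ℤ))
    (hS : ∀ k ∈ S, ∑ i, (k i).natAbs ≤ L) : S.card ≤ 2 ^ L * 3 ^ m := by
  have hsub : S ⊆ Fintype.piFinset fun _ : Fin m => Finset.Icc (-(L : ℤ)) L := by
    intro k hk
    rw [Fintype.mem_piFinset]
    intro i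
    have h := (Finset.single_le_sum (f := fun i => (k i).natAbs) (fun _ _ => Nat.zero_le _)
      (Finset.mem_univ i)).trans (hS k hk)
    simp only [Finset.mem_Icc] at h ⊢
    omega
  have h1 : (S.card : ℝ) * (1 / 2) ^ L ≤ 3 ^ m := by
    calc (S.card : ℝ) * (1 / 2) ^ L = ∑ k ∈ S, (1 / 2 : ℝ) ^ L := by simp
      _ ≤ ∑ k ∈ S, ∏ i, (1 / 2 : ℝ) ^ (k i).natAbs := by
          refine Finset.sum_le_sum fun k hk => ?_
          rw [Finset.prod_pow_eq_pow_sum]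
          exact pow_le_pow_of_le_one (by norm_num) (by norm_num) (hS k hk)
      _ ≤ ∑ k ∈ Fintype.piFinset fun _ : Fin m => Finset.Icc (-(L : ℤ)) L,
            ∏ i, (1 / 2 : ℝ) ^ (k i).natAbs :=
          Finset.sum_le_sum_of_subset_of_nonneg hsub fun _ _ _ => by positivity
      _ = ∏ _i : Fin m, ∑ j ∈ Finset.Icc (-(L : ℤ)) L, (1 / 2 : ℝ) ^ j.natAbs :=
          (Finset.prod_univ_sum (fun _ : Fin m => Finset.Icc (-(L : ℤ)) L)
            (fun _ j => (1 / 2 : ℝ) ^ j.natAbs)).symm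
      _ ≤ ∏ _i : Fin m, (3 : ℝ) := by
          refine Finset.prod_le_prod (fun _ _ => Finset.sum_nonneg fun _ _ => by positivity)
            fun _ _ => ?_
          rw [sum_Icc_half_pow_natAbs]
          have : (0 : ℝ) < (1 / 2) ^ L := by positivity
          linarith
      _ = 3 ^ m := by simp
  rw [one_div, inv_pow, ← div_eq_mul_inv, div_le_iff₀ (by positivity)] at h1
  rw [mul_comm]
  exact_mod_cast h1

/-- The point of the lattice `m^{-1/p} ℤ^m` with integer coordinates `k`. -/
noncomputable def latticeVec {m : ℕ} (p : ℝ) (k : Fin m → ℤ) : Fin m → ℝ :=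
  fun i => (m : ℝ) ^ (-(1 / p)) * k i

lemma sum_natAbs_le_of_pNorm_latticeVec_le {m : ℕ} {p : ℝ} (hp : 2 ≤ p) (hm : 0 < m)
    {k : Fin m → ℤ} (hk : pNorm p (latticeVec p k) ≤ 2) :
    ∑ i, (k i).natAbs ≤ ⌈(2 : ℝ) ^ p⌉₊ * m := by
  have hp0 : 0 < p := by linarith
  have hm' : (0 : ℝ) < m := by exact_mod_cast hm
  have h1 := Real.rpow_le_rpow (pNorm_nonneg _ _) hk hp0.le
  rw [pNorm_rpow hp0] at h1
  have h2 : ∑ i, |latticeVec p k i| ^ p = (m : ℝ)⁻¹ * ∑ i, |(k i : ℝ)| ^ p := by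
    rw [Finset.mul_sum]
    refine Finset.sum_congr rfl fun i _ => ?_
    rw [latticeVec, abs_mul, Real.mul_rpow (abs_nonneg _) (abs_nonneg _),
      abs_of_nonneg (by positivity), ← Real.rpow_mul hm'.le, neg_mul, one_div_mul_cancel hp0.ne',
      Real.rpow_neg_one]
  rw [h2, inv_mul_le_iff₀ hm'] at h1
  have h3 : ((∑ i, (k i).natAbs : ℕ) : ℝ) ≤ ∑ i, |(k i : ℝ)| ^ p := by
    push_cast
    refine Finset.sum_le_sum fun i _ => ?_
    rw [Nat.cast_natAbs, Int.cast_abs]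
    by_cases h0 : k i = 0
    · simp [h0, Real.zero_rpow hp0.ne']
    · have : (1 : ℝ) ≤ |(k i : ℝ)| := by exact_mod_cast Int.one_le_abs h0
      exact Real.self_le_rpow_of_one_le this (by linarith)
  have h4 : ((∑ i, (k i).natAbs : ℕ) : ℝ) ≤ ((⌈(2 : ℝ) ^ p⌉₊ * m : ℕ) : ℝ) := by
    push_cast
    push_cast at h3
    nlinarith [Nat.le_ceil ((2 : ℝ) ^ p)]
  exact_mod_cast h4

lemma finite_pNorm_latticeVec_le {m : ℕ} {p : ℝ} (hp : 2 ≤ p) (hm : 0 < m) :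
    {k : Fin m → ℤ | pNorm p (latticeVec p k) ≤ 2}.Finite := by
  set L : ℕ := ⌈(2 : ℝ) ^ p⌉₊ * m
  refine (Fintype.piFinset fun _ : Fin m => Finset.Icc (-(L : ℤ)) L).finite_toSet.subset ?_
  intro k hk
  rw [Finset.mem_coe, Fintype.mem_piFinset]
  intro i
  have h := (Finset.single_le_sum (f := fun i => (k i).natAbs) (fun _ _ => Nat.zero_le _)
    (Finset.mem_univ i)).trans (sum_natAbs_le_of_pNorm_latticeVec_le hp hm hk)
  simp only [Finset.mem_Icc] at h ⊢
  omega

/-- Rounding every coordinate up or down writes a vector of the unit ball as a convex combination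
of lattice points of norm at most `2`. -/
lemma mem_convexHull_latticeVec {m : ℕ} {p : ℝ} (hp : 2 ≤ p) (hm : 0 < m) {y : Fin m → ℝ}
    (hy : pNorm p y ≤ 1) :
    y ∈ convexHull ℝ (latticeVec p '' {k : Fin m → ℤ | pNorm p (latticeVec p k) ≤ 2}) := by
  have hp0 : 0 < p := by linarith
  have hm' : (0 : ℝ) < m := by exact_mod_cast hm
  set θ : ℝ := (m : ℝ) ^ (-(1 / p)) with hθ
  have hθ0 : 0 < θ := by positivity
  set u : Fin m → ℤ := fun i => ⌊y i / θ⌋ with hu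
  have hlo : ∀ i, θ * u i ≤ y i := fun i => by
    have := Int.floor_le (y i / θ)
    rw [le_div_iff₀ hθ0] at this
    linarith
  have hhi : ∀ i, y i ≤ θ * (u i + 1) := fun i => by
    have := (Int.lt_floor_add_one (y i / θ)).le
    rw [div_le_iff₀ hθ0] at this
    linarith
  have hbox : y ∈ convexHull ℝ (univ.pi fun i => ({θ * u i, θ * (u i + 1)} : Set ℝ)) := by
    rw [convexHull_pi]
    intro i _
    beta_reduce
    rw [convexHull_pair, segment_eq_Icc (by nlinarith)]
    exact ⟨hlo i, hhi i⟩
  refine convexHull_mono ?_ hbox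
  intro z hz
  have hz' : ∀ i, ∃ a : ℤ, z i = θ * a ∧ |z i - y i| ≤ θ := by
    intro i
    have h1 := hlo i
    have h2 := hhi i
    rcases hz i (mem_univ i) with h | h
    · exact ⟨u i, h, by rw [h, abs_le]; constructor <;> nlinarith⟩
    · rw [mem_singleton_iff] at h
      exact ⟨u i + 1, by rw [h]; push_cast; ring, by rw [h, abs_le]; constructor <;> nlinarith⟩
  choose k hk hky using hz'
  have hzk : latticeVec p k = z := funext fun i => (hk i).symm
  refine ⟨k, ?_, hzk⟩
  rw [mem_ofPred_eq, hzk]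
  have h1 : pNorm p (z - y) ≤ 1 := by
    refine (pNorm_le_of_abs_le hp0 hθ0.le hky).trans_eq ?_
    rw [hθ, ← Real.rpow_add hm', add_neg_cancel, Real.rpow_zero]
  have h2 := pNorm_add_le (by linarith : 1 ≤ p) y (z - y)
  rw [add_sub_cancel] at h2
  linarith

/-- Rank-one matrices built from a sign vector and a lattice point of norm at most `2`. -/
def rankOneAtoms (p : ℝ) (m n : ℕ) : Set (Matrix (Fin m) (Fin n) ℝ) :=
  (fun a : (Fin n → Bool) × (Fin m → ℤ) =>
    vecMulVec (latticeVec p a.2) (fun j => boolSign (a.1 j))) ''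
      (univ ×ˢ {k : Fin m → ℤ | pNorm p (latticeVec p k) ≤ 2})

lemma finite_rankOneAtoms {m : ℕ} {p : ℝ} (hp : 2 ≤ p) (hm : 0 < m) (n : ℕ) :
    (rankOneAtoms p m n).Finite :=
  (finite_univ.prod (finite_pNorm_latticeVec_le hp hm)).image _

lemma ncard_rankOneAtoms_le {m : ℕ} {p : ℝ} (hp : 2 ≤ p) (hm : 0 < m) (n : ℕ) :
    (rankOneAtoms p m n).ncard ≤ 2 ^ ((⌈(2 : ℝ) ^ p⌉₊ + 2) * (n + m)) := by
  have hfin := finite_pNorm_latticeVec_le hp hm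
  have hcard : {k : Fin m → ℤ | pNorm p (latticeVec p k) ≤ 2}.ncard
      ≤ 2 ^ (⌈(2 : ℝ) ^ p⌉₊ * m) * 3 ^ m := by
    rw [Set.ncard_eq_toFinset_card _ hfin]
    refine card_le_of_sum_natAbs_le _ fun k hk => ?_
    exact sum_natAbs_le_of_pNorm_latticeVec_le hp hm (hfin.mem_toFinset.1 hk)
  calc (rankOneAtoms p m n).ncard
      ≤ ((univ : Set (Fin n → Bool)) ×ˢ {k : Fin m → ℤ | pNorm p (latticeVec p k) ≤ 2}).ncard :=
        Set.ncard_image_le (finite_univ.prod hfin)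
    _ = 2 ^ n * {k : Fin m → ℤ | pNorm p (latticeVec p k) ≤ 2}.ncard := by
        rw [Set.ncard_prod, Set.ncard_univ]; simp
    _ ≤ 2 ^ n * (2 ^ (⌈(2 : ℝ) ^ p⌉₊ * m) * 4 ^ m) := by
        gcongr
        exact hcard.trans (by gcongr; norm_num)
    _ = 2 ^ (n + (⌈(2 : ℝ) ^ p⌉₊ * m + 2 * m)) := by
        rw [pow_add, pow_add, pow_mul 2 2 m]; norm_num
    _ ≤ _ := by
        refine Nat.pow_le_pow_right (by norm_num) ?_
        nlinarith [Nat.zero_le (⌈(2 : ℝ) ^ p⌉₊ * n)]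

lemma injNormInfP_le_two_of_mem_rankOneAtoms {m n : ℕ} {p : ℝ} (hp : 2 ≤ p)
    {M : Matrix (Fin m) (Fin n) ℝ} (hM : M ∈ rankOneAtoms p m n) : injNormInfP p M ≤ 2 := by
  obtain ⟨⟨s, k⟩, ⟨-, hk⟩, rfl⟩ := hM
  refine injNormInfP_le (by norm_num) fun j => ?_
  have h : (fun i => vecMulVec (latticeVec p k) (fun j => boolSign (s j)) i j)
      = boolSign (s j) • latticeVec p k := by
    funext i; simp [vecMulVec_apply, mul_comm]
  have hs : |boolSign (s j)| = 1 := by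
    unfold boolSign; split_ifs <;> simp
  simp only
  rw [h, pNorm_smul (by linarith), hs, one_mul]
  exact hk

lemma mem_convexHull_boolSign {n : ℕ} {x : Fin n → ℝ} (hx : ∀ j, |x j| ≤ 1) :
    x ∈ convexHull ℝ (range fun (s : Fin n → Bool) j => boolSign (s j)) := by
  have hbox : x ∈ convexHull ℝ (univ.pi fun _ : Fin n => ({-1, 1} : Set ℝ)) := by
    rw [convexHull_pi]
    intro j _
    rw [convexHull_pair, segment_eq_Icc (by norm_num)]
    exact abs_le.1 (hx j)
  refine convexHull_mono ?_ hbox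
  intro z hz
  refine ⟨fun j => decide (z j = 1), funext fun j => ?_⟩
  rcases hz j (mem_univ j) with h | h
  · norm_num [h, boolSign]
  · simp [mem_singleton_iff.1 h, boolSign]

lemma vecMulVec_mem_convexHull_rankOneAtoms {m n : ℕ} {p : ℝ} (hp : 2 ≤ p) (hm : 0 < m)
    {x : Fin n → ℝ} {y : Fin m → ℝ} (hx : ∀ j, |x j| ≤ 1) (hy : pNorm p y ≤ 1) :
    vecMulVec y x ∈ convexHull ℝ (rankOneAtoms p m n) := by
  set K := convexHull ℝ (rankOneAtoms p m n)
  have hK : Convex ℝ K := convex_convexHull ℝ _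
  let Φ := vecMulVecBilin (m := Fin m) (n := Fin n) ℝ ℝ (A := ℝ)
  have h1 : convexHull ℝ (latticeVec p '' {k : Fin m → ℤ | pNorm p (latticeVec p k) ≤ 2}) ⊆
      (Φ.flip x) ⁻¹' K := by
    refine convexHull_min ?_ (hK.linear_preimage (Φ.flip x))
    rintro _ ⟨k, hk, rfl⟩
    have h2 : convexHull ℝ (range fun (s : Fin n → Bool) j => boolSign (s j)) ⊆
        (Φ (latticeVec p k)) ⁻¹' K := by
      refine convexHull_min ?_ (hK.linear_preimage (Φ (latticeVec p k)))
      rintro _ ⟨s, rfl⟩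
      exact subset_convexHull ℝ _ ⟨(s, k), ⟨mem_univ _, hk⟩, rfl⟩
    exact h2 (mem_convexHull_boolSign hx)
  exact h1 (mem_convexHull_latticeVec hp hm hy)

lemma half_smul_mem_convexHull_rankOneAtoms {m n : ℕ} {p : ℝ} (hp : 2 ≤ p) (hm : 0 < m)
    {M : Matrix (Fin m) (Fin n) ℝ} (hM : projNormInfP p M ≤ 1) :
    (1 / 2 : ℝ) • M ∈ convexHull ℝ (rankOneAtoms p m n) := by
  have hp0 : 0 < p := by linarith
  have hne : {c | ∃ (s : ℕ) (x : Fin s → (Fin n → ℝ)) (y : Fin s → (Fin m → ℝ)),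
      (∀ a b, M a b = ∑ i, y i a * x i b) ∧
        c = ∑ i, supNorm (x i) * pNorm p (y i)}.Nonempty := by
    refine ⟨_, m, fun i => M i, fun i => Pi.single i 1, fun a b => ?_, rfl⟩
    simp [Pi.single_apply]
  obtain ⟨c, ⟨s, x, y, hMxy, rfl⟩, hc⟩ := exists_lt_of_csInf_lt hne
    (lt_of_le_of_lt hM one_lt_two)
  have hsup0 : ∀ i, 0 ≤ supNorm (x i) := fun i => Real.iSup_nonneg fun _ => abs_nonneg _
  have hsup : ∀ i j, |x i j| ≤ supNorm (x i) := fun i j =>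
    le_ciSup (f := fun j => |x i j|) (Set.finite_range _).bddAbove j
  set X : Fin s → Fin n → ℝ := fun i => (supNorm (x i))⁻¹ • x i with hX
  set Y : Fin s → Fin m → ℝ := fun i => (pNorm p (y i))⁻¹ • y i with hY
  have hX1 : ∀ i j, |X i j| ≤ 1 := by
    intro i j
    simp only [hX, Pi.smul_apply, smul_eq_mul]
    rw [abs_mul, abs_of_nonneg (inv_nonneg.2 (hsup0 i))]
    calc _ ≤ (supNorm (x i))⁻¹ * supNorm (x i) := by
          gcongr
          · exact inv_nonneg.2 (hsup0 i)
          · exact hsup i j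
      _ ≤ 1 := inv_mul_le_one
  have hY1 : ∀ i, pNorm p (Y i) ≤ 1 := by
    intro i
    rw [hY, pNorm_smul hp0, abs_of_nonneg (inv_nonneg.2 (pNorm_nonneg _ _))]
    exact inv_mul_le_one
  have hxX : ∀ i j, x i j = supNorm (x i) * X i j := by
    intro i j
    by_cases h0 : supNorm (x i) = 0
    · have := hsup i j
      rw [h0] at this ⊢
      rw [zero_mul]
      exact abs_nonpos_iff.1 this
    · simp [hX, h0]
  have hyY : ∀ i j, y i j = pNorm p (y i) * Y i j := by
    intro i j
    by_cases h0 : pNorm p (y i) = 0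
    · have := abs_le_pNorm hp0 (y i) j
      rw [h0] at this ⊢
      rw [zero_mul]
      exact abs_nonpos_iff.1 this
    · simp [hY, h0]
  set w : Fin s → ℝ := fun i => supNorm (x i) * pNorm p (y i) / 2 with hw
  have hw0 : ∀ i, 0 ≤ w i := fun i =>
    div_nonneg (mul_nonneg (hsup0 i) (pNorm_nonneg _ _)) zero_le_two
  have hw1 : ∑ i, w i ≤ 1 := by rw [hw, ← Finset.sum_div]; linarith
  have hrep : (1 / 2 : ℝ) • M = ∑ i, w i • vecMulVec (Y i) (X i) := by
    ext a b
    rw [Matrix.smul_apply, hMxy, Matrix.sum_apply, smul_eq_mul, Finset.mul_sum]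
    refine Finset.sum_congr rfl fun i _ => ?_
    rw [Matrix.smul_apply, vecMulVec_apply, hxX i b, hyY i a, smul_eq_mul, hw]
    ring
  have hzero : (0 : Matrix (Fin m) (Fin n) ℝ) ∈ convexHull ℝ (rankOneAtoms p m n) := by
    have := vecMulVec_mem_convexHull_rankOneAtoms (n := n) hp hm (x := 0) (y := 0) (by simp)
      (by simp [pNorm, Real.zero_rpow hp0.ne', Real.zero_rpow (inv_pos.2 hp0).ne'])
    simpa using this
  have hfin := (convex_convexHull ℝ (rankOneAtoms p m n)).sum_mem
    (t := (Finset.univ : Finset (Option (Fin s))))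
    (w := fun o => o.elim (1 - ∑ i, w i) w)
    (z := fun o => o.elim 0 fun i => vecMulVec (Y i) (X i))
    (by rintro (_ | i) _ <;> simp [hw0, hw1]) (by simp)
    (by
      rintro (_ | i) _
      · exact hzero
      · exact vecMulVec_mem_convexHull_rankOneAtoms hp hm (hX1 i) (hY1 i))
  rw [hrep]
  simpa [Fintype.sum_option] using hfin

lemma injNormInfP_le_four_of_projNormInfP_le_one {m n : ℕ} {p : ℝ} (hp : 2 ≤ p) (hm : 0 < m)
    {M : Matrix (Fin m) (Fin n) ℝ} (hM : projNormInfP p M ≤ 1) : injNormInfP p M ≤ 4 := by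
  obtain ⟨f, hf, hle⟩ := (convexOn_injNormInfP (by linarith : 1 ≤ p)).exists_ge_of_mem_convexHull
    (subset_univ _) (half_smul_mem_convexHull_rankOneAtoms hp hm hM)
  have := hle.trans (injNormInfP_le_two_of_mem_rankOneAtoms hp hf)
  rw [injNormInfP_smul (by linarith), abs_of_pos (by norm_num)] at this
  linarith

/-- Maurey's empirical method. -/
lemma exists_empirical_approx {m n q : ℕ} {p : ℝ} (hp : 2 ≤ p) (hm : 0 < m) (hq : p ≤ q)
    (hnq : 2 * (n : ℝ) ≤ exp q) {N : ℕ} (hN : 0 < N) {M : Matrix (Fin m) (Fin n) ℝ}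
    (hM : projNormInfP p M ≤ 1) :
    ∃ τ : Fin N → rankOneAtoms p m n,
      injNormInfP p (M - (2 / N : ℝ) • ∑ t, (τ t : Matrix (Fin m) (Fin n) ℝ))
        ≤ 8 * exp 1 * √(exp 1 * q) / √N := by
  have hN' : (0 : ℝ) < N := by exact_mod_cast hN
  have hp1 : 1 ≤ p := by linarith
  have hfin := finite_rankOneAtoms hp hm n
  have hmem := half_smul_mem_convexHull_rankOneAtoms hp hm hM
  have : Fintype (rankOneAtoms p m n) := hfin.fintype
  rw [← Set.coe_toFinset (rankOneAtoms p m n), Finset.mem_convexHull'] at hmem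
  obtain ⟨w, hw0, hw1, hwM⟩ := hmem
  obtain ⟨τ, hτ⟩ := exists_empirical_mean (convexOn_injNormInfP hp1)
    (w := fun i : rankOneAtoms p m n => w i) (fun i => hw0 i (by simp))
    (by rw [← hw1]; exact (Finset.sum_subtype _ (by simp) w).symm)
    (fun i => (i : Matrix (Fin m) (Fin n) ℝ)) N
    (B := exp 1 * (√(exp 1 * q) * (√N * 4))) (fun g => by
      refine sum_injNormInfP_signed_sum_le hp (by norm_num) hq hnq _ fun t => ?_
      have h1 := injNormInfP_le_two_of_mem_rankOneAtoms hp (g t).1.2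
      have h2 := injNormInfP_le_two_of_mem_rankOneAtoms hp (g t).2.2
      linarith [injNormInfP_sub_le hp1 ((g t).1 : Matrix (Fin m) (Fin n) ℝ) (g t).2])
  have hmean : ∑ i : rankOneAtoms p m n, w i • (i : Matrix (Fin m) (Fin n) ℝ)
      = (1 / 2 : ℝ) • M := by
    rw [← hwM]
    exact (Finset.sum_subtype _ (by simp) fun y => w y • y).symm
  rw [hmean] at hτ
  refine ⟨τ, ?_⟩
  have hrw : M - (2 / N : ℝ) • ∑ t, (τ t : Matrix (Fin m) (Fin n) ℝ)
      = (-(2 / N) : ℝ) • (∑ t, (τ t : Matrix (Fin m) (Fin n) ℝ) - (N : ℝ) • (1 / 2 : ℝ) • M) := by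
    rw [smul_sub, smul_smul, smul_smul]
    have : -(2 / (N : ℝ)) * N * (1 / 2) = -1 := by field_simp
    rw [this]
    module
  rw [hrw, injNormInfP_smul (by linarith), abs_neg, abs_of_pos (by positivity)]
  calc _ ≤ 2 / N * (exp 1 * (√(exp 1 * q) * (√N * 4))) := by gcongr
    _ = 8 * exp 1 * √(exp 1 * q) * (√N / N) := by ring
    _ = _ := by rw [Real.sqrt_div_self']; ring

lemma entropyNumberBalls_nonneg {V : Type*} [AddCommGroup V] [Module ℝ V] (D E : Set V) (k : ℕ) :
    0 ≤ entropyNumberBalls D E k :=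
  Real.sInf_nonneg fun _ h => h.1.le

/-- A cover by `2 ^ k` balls of radius `ε / 2` bounds the entropy number by `ε`. -/
lemma entropyNumberBalls_le_of_cover {m n k : ℕ} {p ε : ℝ} (hp : 1 ≤ p) (hε : 0 < ε)
    {D : Set (Matrix (Fin m) (Fin n) ℝ)} {J : Type*} [Finite J]
    (c : J → Matrix (Fin m) (Fin n) ℝ) (hJ : Nat.card J ≤ 2 ^ k)
    (hc : ∀ M ∈ D, ∃ j, injNormInfP p (M - c j) ≤ ε / 2) :
    entropyNumberBalls D {M : Matrix (Fin m) (Fin n) ℝ | injNormInfP p M ≤ 1} (k + 1) ≤ ε := by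
  refine csInf_le ⟨0, fun _ h => h.1.le⟩ ⟨hε, sSup_le ?_⟩
  rintro _ ⟨l, y, rfl, hyD, hsep⟩
  choose j hj using fun i => hc (y i) (hyD i)
  have hinj : Function.Injective j := by
    intro a b hab
    by_contra hne
    refine hsep a b hne ?_
    rw [Set.mem_smul_set_iff_inv_smul_mem₀ hε.ne', mem_ofPred_eq,
      injNormInfP_smul (by linarith), abs_of_pos (inv_pos.2 hε), inv_mul_le_iff₀ hε, mul_one]
    have h1 := injNormInfP_sub_le hp (y a - c (j a)) (y b - c (j b))
    rw [hab, sub_sub_sub_cancel_right] at h1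
    have h2 := hj a
    rw [hab] at h2
    linarith [hj b]
  have hcard := (Nat.card_le_card_of_injective j hinj).trans hJ
  rw [Nat.card_fin] at hcard
  rw [Nat.add_sub_cancel]
  exact_mod_cast hcard

lemma entropyNumberBalls_le_eight {m : ℕ} {p : ℝ} (hp : 2 ≤ p) (hm : 0 < m) (n k : ℕ) :
    entropyNumberBalls {M : Matrix (Fin m) (Fin n) ℝ | projNormInfP p M ≤ 1}
      {M : Matrix (Fin m) (Fin n) ℝ | injNormInfP p M ≤ 1} (k + 1) ≤ 8 := by
  refine entropyNumberBalls_le_of_cover (J := Unit) (by linarith) (by norm_num) (fun _ => 0)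
    (by simpa using Nat.one_le_two_pow) fun M hM => ⟨(), ?_⟩
  rw [sub_zero]
  exact (injNormInfP_le_four_of_projNormInfP_le_one hp hm hM).trans (by norm_num)

lemma entropyNumberBalls_le_of_empirical {m n q N k : ℕ} {p : ℝ} (hp : 2 ≤ p) (hm : 0 < m)
    (hq : p ≤ q) (hnq : 2 * (n : ℝ) ≤ exp q) (hN : 0 < N)
    (hk : (⌈(2 : ℝ) ^ p⌉₊ + 2) * (n + m) * N ≤ k) :
    entropyNumberBalls {M : Matrix (Fin m) (Fin n) ℝ | projNormInfP p M ≤ 1}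
      {M : Matrix (Fin m) (Fin n) ℝ | injNormInfP p M ≤ 1} (k + 1)
        ≤ 16 * exp 1 * √(exp 1 * q) / √N := by
  have hN' : (0 : ℝ) < N := by exact_mod_cast hN
  have hq0 : (0 : ℝ) < q := by linarith
  have : Finite (rankOneAtoms p m n) := finite_rankOneAtoms hp hm n
  refine entropyNumberBalls_le_of_cover (J := Fin N → rankOneAtoms p m n) (by linarith)
    (by positivity) (fun τ => (2 / N : ℝ) • ∑ t, (τ t : Matrix (Fin m) (Fin n) ℝ)) ?_
    fun M hM => ?_
  · rw [Nat.card_fun, Nat.card_fin, Nat.card_coe_set_eq]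
    calc _ ≤ (2 ^ ((⌈(2 : ℝ) ^ p⌉₊ + 2) * (n + m))) ^ N := by
          gcongr
          exact ncard_rankOneAtoms_le hp hm n
      _ ≤ 2 ^ k := by
          rw [← pow_mul]
          exact Nat.pow_le_pow_right (by norm_num) hk
  · obtain ⟨τ, hτ⟩ := exists_empirical_approx hp hm hq hnq hN hM
    exact ⟨τ, hτ.trans_eq (by ring)⟩

lemma entropyNumberBalls_le_of_grid {m n r k : ℕ} {p : ℝ} (hp : 2 ≤ p) (hm : 0 < m)
    (hk : (r + 4) * (n * m) ≤ k) :
    entropyNumberBalls {M : Matrix (Fin m) (Fin n) ℝ | projNormInfP p M ≤ 1}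
      {M : Matrix (Fin m) (Fin n) ℝ | injNormInfP p M ≤ 1} (k + 1) ≤ 2 * m / 2 ^ r := by
  have hp0 : 0 < p := by linarith
  have hm' : (1 : ℝ) ≤ m := by exact_mod_cast hm
  have hR : (0 : ℝ) < 2 ^ r := by positivity
  refine entropyNumberBalls_le_of_cover
    (J := Fin m → Fin n → Finset.Icc (-(4 * 2 ^ r) : ℤ) (4 * 2 ^ r)) (by linarith)
    (by positivity) (fun z => Matrix.of fun i j => ((z i j : ℤ) : ℝ) / 2 ^ r) ?_
    fun M hM => ?_
  · rw [Nat.card_fun, Nat.card_fun, Nat.card_fin, Nat.card_fin, Nat.card_eq_fintype_card,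
      Fintype.card_coe, Int.card_Icc]
    have h1 : ((4 * 2 ^ r + 1 - -(4 * 2 ^ r) : ℤ)).toNat ≤ 2 ^ (r + 4) := by
      have h2 : (1 : ℤ) ≤ 2 ^ r := one_le_pow₀ (by norm_num)
      rw [Int.toNat_le]
      push_cast
      rw [pow_add]
      linarith
    calc _ ≤ ((2 ^ (r + 4)) ^ n) ^ m := by gcongr
      _ ≤ 2 ^ k := by
          rw [← pow_mul, ← pow_mul]
          exact Nat.pow_le_pow_right (by norm_num) hk
  · have hM4 := injNormInfP_le_four_of_projNormInfP_le_one hp hm hM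
    have hent : ∀ i j, |M i j| ≤ 4 := fun i j =>
      ((abs_le_pNorm hp0 (fun i => M i j) i).trans (pNorm_col_le_injNormInfP p M j)).trans hM4
    refine ⟨fun i j => ⟨⌊M i j * 2 ^ r⌋, ?_⟩, ?_⟩
    · obtain ⟨h1, h2⟩ := abs_le.1 (hent i j)
      rw [Finset.mem_Icc]
      constructor
      · rw [Int.le_floor]; push_cast; nlinarith
      · have : (⌊M i j * 2 ^ r⌋ : ℝ) ≤ 4 * 2 ^ r := (Int.floor_le _).trans (by nlinarith)
        exact_mod_cast this
    · have hpow : (m : ℝ) ^ (1 / p) ≤ m := by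
        conv_rhs => rw [← Real.rpow_one (m : ℝ)]
        exact Real.rpow_le_rpow_of_exponent_le hm' (by rw [div_le_one hp0]; linarith)
      refine injNormInfP_le (by positivity) fun j => ?_
      refine (pNorm_le_of_abs_le (δ := 1 / 2 ^ r) hp0 (by positivity) fun i => ?_).trans ?_
      · simp only [Matrix.sub_apply, Matrix.of_apply]
        have h1 := Int.floor_le (M i j * 2 ^ r)
        have h2 := (Int.lt_floor_add_one (M i j * 2 ^ r)).le
        rw [abs_of_nonneg]
        · rw [sub_le_iff_le_add, ← add_div, le_div_iff₀ hR]; linarith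
        · rw [sub_nonneg, div_le_iff₀ hR]; exact h1
      · calc _ ≤ (m : ℝ) * (1 / 2 ^ r) := by gcongr
          _ = _ := by ring

lemma entropyNumberBalls_le_sqrt {m n : ℕ} {p : ℝ} (hp : 2 ≤ p) (hn : 0 < n) (hm : 0 < m)
    (k : ℕ) :
    entropyNumberBalls {M : Matrix (Fin m) (Fin n) ℝ | projNormInfP p M ≤ 1}
      {M : Matrix (Fin m) (Fin n) ℝ | injNormInfP p M ≤ 1} (k + 1)
        ≤ (8 + 16 * exp 1 * √(2 * exp 1 * (p + 2))) *
          (√((1 + log n) * ((⌈(2 : ℝ) ^ p⌉₊ + 2) * (n + m))) / √(k + 1)) := by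
  have hn1 : (1 : ℝ) ≤ n := by exact_mod_cast hn
  have hlog : 0 ≤ log n := Real.log_nonneg hn1
  set T : ℕ := (⌈(2 : ℝ) ^ p⌉₊ + 2) * (n + m) with hT
  have hT0 : 0 < T := by positivity
  have hTc : ((⌈(2 : ℝ) ^ p⌉₊ : ℝ) + 2) * (n + m) = T := by rw [hT]; push_cast; ring
  have hT' : (0 : ℝ) < T := by exact_mod_cast hT0
  have hk' : (0 : ℝ) < k + 1 := by positivity
  rw [hTc, ← Real.sqrt_div (by positivity)]
  rcases lt_or_ge k T with hkT | hkT
  · have h1 : (1 : ℝ) ≤ √((1 + log n) * T / (k + 1)) := by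
      rw [Real.one_le_sqrt, one_le_div hk']
      have : (k : ℝ) + 1 ≤ T := by exact_mod_cast hkT
      nlinarith
    have h2 : (8 : ℝ) ≤ 8 + 16 * exp 1 * √(2 * exp 1 * (p + 2)) := by
      have : 0 ≤ 16 * exp 1 * √(2 * exp 1 * (p + 2)) := by positivity
      linarith
    calc _ ≤ (8 : ℝ) := entropyNumberBalls_le_eight hp hm n k
      _ ≤ _ := by nlinarith
  · set N : ℕ := k / T with hN
    have hN0 : 0 < N := Nat.div_pos hkT hT0
    have hN' : (0 : ℝ) < N := by exact_mod_cast hN0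
    set q : ℕ := ⌈p + log (2 * n)⌉₊ with hq
    have hlog2n : log (2 * n) = log 2 + log n := Real.log_mul (by norm_num) (by positivity)
    have hl2 : 0 < log 2 := Real.log_pos (by norm_num)
    have hl2' : log 2 ≤ 1 := by linarith [Real.log_two_lt_d9]
    have hqle : p + log (2 * n) ≤ q := Nat.le_ceil _
    have hpq : p ≤ q := by linarith
    have hnq : 2 * (n : ℝ) ≤ exp q := by
      rw [← Real.log_le_iff_le_exp (by positivity)]; linarith
    have hqu : (q : ℝ) ≤ (p + 2) * (1 + log n) := by
      have := (Nat.ceil_lt_add_one (show 0 ≤ p + log (2 * n) by linarith)).le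
      nlinarith
    have hkN : (k : ℝ) + 1 ≤ 2 * N * T := by
      have h1 : k < (N + 1) * T := by
        rw [hN, mul_comm]; exact Nat.lt_mul_div_succ k hT0
      have h2 : k + 1 ≤ 2 * N * T := by nlinarith
      exact_mod_cast h2
    have h1 := entropyNumberBalls_le_of_empirical hp hm hpq hnq hN0
      (k := k) (Nat.mul_div_le k T)
    refine h1.trans ?_
    rw [mul_div_assoc, ← Real.sqrt_div (by positivity)]
    have h2 : √(exp 1 * q / N) ≤ √(2 * exp 1 * (p + 2)) * √((1 + log n) * T / (k + 1)) := by
      rw [← Real.sqrt_mul (by positivity)]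
      apply Real.sqrt_le_sqrt
      rw [← mul_div_assoc, div_le_div_iff₀ hN' hk']
      calc exp 1 * q * (k + 1) ≤ exp 1 * ((p + 2) * (1 + log n)) * (2 * N * T) := by gcongr
        _ = _ := by ring
    calc _ ≤ 16 * exp 1 * (√(2 * exp 1 * (p + 2)) * √((1 + log n) * T / (k + 1))) := by gcongr
      _ = 16 * exp 1 * √(2 * exp 1 * (p + 2)) * √((1 + log n) * T / (k + 1)) := by ring
      _ ≤ _ := by gcongr; linarith

lemma succ_pow_five_le (l : ℕ) : (l + 1) ^ 5 ≤ 1000 * 2 ^ l := by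
  rcases lt_or_ge l 6 with h | h
  · interval_cases l <;> norm_num
  · induction l, h using Nat.le_induction with
    | base => norm_num
    | succ l hl ih =>
      have h1 : (l + 1 + 1) ^ 5 ≤ 2 * (l + 1) ^ 5 := by
        obtain ⟨a, rfl⟩ := Nat.exists_eq_add_of_le hl
        ring_nf
        nlinarith [Nat.zero_le a, Nat.zero_le (a ^ 2), Nat.zero_le (a ^ 3), Nat.zero_le (a ^ 4),
          Nat.zero_le (a ^ 5)]
      rw [pow_succ 2 l]
      linarith

lemma entropyNumberBalls_le_inv_sq {m n k : ℕ} {p : ℝ} (hp : 2 ≤ p) (hn : 0 < n) (hm : 0 < m)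
    (hk : (n * m) ^ 2 ≤ k) :
    entropyNumberBalls {M : Matrix (Fin m) (Fin n) ℝ | projNormInfP p M ≤ 1}
      {M : Matrix (Fin m) (Fin n) ℝ | injNormInfP p M ≤ 1} (k + 1)
        ≤ 32000 / ((k : ℝ) + 1) ^ 2 := by
  set d : ℕ := n * m with hd
  have hd0 : 0 < d := by positivity
  have hmd : m ≤ d := Nat.le_mul_of_pos_left m hn
  set l : ℕ := k / d with hl
  have hdl : d ≤ l := by rw [hl, Nat.le_div_iff_mul_le hd0, ← sq]; exact hk
  have hkl : k + 1 ≤ (l + 1) ^ 2 := by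
    have h1 : k < d * (l + 1) := Nat.lt_mul_div_succ k hd0
    nlinarith
  have hk2 : (k + 1) ^ 2 ≤ (l + 1) ^ 4 := by
    calc (k + 1) ^ 2 ≤ ((l + 1) ^ 2) ^ 2 := by gcongr
      _ = _ := by ring
  rw [le_div_iff₀ (by positivity)]
  have hk2' : ((k : ℝ) + 1) ^ 2 ≤ ((l : ℝ) + 1) ^ 4 := by exact_mod_cast hk2
  rcases lt_or_ge l 4 with h4 | h4
  · have h8 := entropyNumberBalls_le_eight hp hm n k
    have hl4 : ((l : ℝ) + 1) ≤ 4 := by exact_mod_cast h4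
    have h256 : ((l : ℝ) + 1) ^ 4 ≤ 4 ^ 4 := by gcongr
    calc _ ≤ (8 : ℝ) * 4 ^ 4 := by
          gcongr
          exact hk2'.trans h256
      _ ≤ _ := by norm_num
  · obtain ⟨r, hr⟩ := Nat.exists_eq_add_of_le' h4
    have h1 := entropyNumberBalls_le_of_grid (r := r) (k := k) hp hm
      (by rw [← hr]; exact Nat.div_mul_le_self k d)
    have h5 : ((l : ℝ) + 1) ^ 5 ≤ 1000 * 2 ^ l := by exact_mod_cast succ_pow_five_le l
    have hml : (m : ℝ) ≤ l + 1 := by exact_mod_cast (hmd.trans hdl).trans (Nat.le_succ l)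
    calc _ ≤ 2 * (m : ℝ) / 2 ^ r * (l + 1) ^ 4 := by gcongr
      _ ≤ 2 * ((l : ℝ) + 1) / 2 ^ r * (l + 1) ^ 4 := by gcongr
      _ = 2 * ((l : ℝ) + 1) ^ 5 / 2 ^ r := by ring
      _ ≤ 2 * (1000 * 2 ^ l) / 2 ^ r := by gcongr
      _ = 32000 := by rw [hr, pow_add]; field_simp; norm_num

lemma sum_range_inv_succ_sq_le (K : ℕ) :
    ∑ k ∈ Finset.range K, 1 / ((k : ℝ) + 1) ^ 2 ≤ 2 := by
  have h := sum_Ioo_inv_sq_le (α := ℝ) 0 (K + 1)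
  have e : Finset.Ioo 0 (K + 1) = Finset.Ico (0 + 1) (K + 1) := by
    ext; simp only [Finset.mem_Ioo, Finset.mem_Ico]; omega
  rw [e, ← Finset.sum_Ico_add' (fun i : ℕ => ((i : ℝ) ^ 2)⁻¹) 0 K 1] at h
  simpa using h

/-- If `a` is bounded by `A / (k + 1)` for `k < K` and by `B / (k + 1) ^ 2` beyond, then its sum is
at most logarithmic in `K`. -/
lemma tsum_le_of_harmonic_of_inv_sq {a : ℕ → ℝ} {A B : ℝ} {K : ℕ} (ha : ∀ k, 0 ≤ a k)
    (hA : 0 ≤ A) (hB : 0 ≤ B) (h1 : ∀ k, a k ≤ A / (k + 1))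
    (h2 : ∀ k, K ≤ k → a k ≤ B / ((k : ℝ) + 1) ^ 2) :
    ∑' k, a k ≤ A * (1 + log K) + 2 * B := by
  refine Real.tsum_le_of_sum_range_le ha fun J => ?_
  have hpt : ∀ k, a k ≤ (if k < K then A / (k + 1) else 0) + B * (1 / ((k : ℝ) + 1) ^ 2) := by
    intro k
    have hBk : 0 ≤ B * (1 / ((k : ℝ) + 1) ^ 2) := by positivity
    split_ifs with hk
    · linarith [h1 k]
    · rw [zero_add, mul_one_div]; exact h2 k (not_lt.1 hk)
  have hharm : ∑ k ∈ Finset.range K, A / ((k : ℝ) + 1) ≤ A * (1 + log K) := by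
    have h := harmonic_le_one_add_log K
    rw [harmonic] at h
    push_cast at h
    simp_rw [div_eq_mul_inv]
    rw [← Finset.mul_sum]
    gcongr
  calc ∑ k ∈ Finset.range J, a k
      ≤ ∑ k ∈ Finset.range J,
          ((if k < K then A / ((k : ℝ) + 1) else 0) + B * (1 / ((k : ℝ) + 1) ^ 2)) :=
        Finset.sum_le_sum fun k _ => hpt k
    _ = ∑ k ∈ Finset.range J with k < K, A / ((k : ℝ) + 1)
          + B * ∑ k ∈ Finset.range J, 1 / ((k : ℝ) + 1) ^ 2 := by
        rw [Finset.sum_add_distrib, Finset.sum_filter, Finset.mul_sum]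
    _ ≤ ∑ k ∈ Finset.range K, A / ((k : ℝ) + 1) + B * 2 := by
        gcongr
        · intro k hk
          simpa using (Finset.mem_filter.1 hk).2
        · exact sum_range_inv_succ_sq_le J
    _ ≤ _ := by linarith

theorem stmt_13 (p : ℝ) (hp : 2 ≤ p) :
    ∃ C : ℝ, 0 < C ∧
    ∀ (n m : ℕ), 0 < n → 0 < m →
      E21balls {M : Matrix (Fin m) (Fin n) ℝ | projNormInfP p M ≤ 1}
          {M : Matrix (Fin m) (Fin n) ℝ | injNormInfP p M ≤ 1}
        ≤ C * Real.sqrt (1 + n + m) * (1 + Real.log n + Real.log m) ^ ((3:ℝ)/2) := by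
  set C₁ : ℝ := 8 + 16 * exp 1 * √(2 * exp 1 * (p + 2)) with hC₁
  set c : ℝ := ⌈(2 : ℝ) ^ p⌉₊ + 2 with hc
  have hC₁0 : 0 < C₁ := by positivity
  have hc0 : 0 < c := by positivity
  refine ⟨2 * (C₁ * √c) + 64000, by positivity, fun n m hn hm => ?_⟩
  have hn1 : (1 : ℝ) ≤ n := by exact_mod_cast hn
  have hm1 : (1 : ℝ) ≤ m := by exact_mod_cast hm
  have hln : 0 ≤ log n := Real.log_nonneg hn1
  have hlm : 0 ≤ log m := Real.log_nonneg hm1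
  set X : ℝ := 1 + log n + log m with hX
  have hX1 : 1 ≤ X := by linarith
  set S : ℝ := √(1 + n + m) with hS
  have hS1 : 1 ≤ S := Real.one_le_sqrt.2 (by linarith)
  have hX32 : X ^ ((3 : ℝ) / 2) = √X * X := by
    rw [Real.sqrt_eq_rpow, ← Real.rpow_add_one (by linarith)]; norm_num
  have hsX1 : 1 ≤ √X := Real.one_le_sqrt.2 hX1
  have hsum := tsum_le_of_harmonic_of_inv_sq
    (a := fun k : ℕ => entropyNumberBalls {M : Matrix (Fin m) (Fin n) ℝ | projNormInfP p M ≤ 1}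
      {M : Matrix (Fin m) (Fin n) ℝ | injNormInfP p M ≤ 1} (k + 1) / √(k + 1))
    (A := C₁ * √((1 + log n) * (c * (n + m)))) (B := 32000) (K := (n * m) ^ 2)
    (fun k => div_nonneg (entropyNumberBalls_nonneg _ _ _) (Real.sqrt_nonneg _))
    (by positivity) (by norm_num)
    (fun k => by
      have hk : (0 : ℝ) < k + 1 := by positivity
      rw [div_le_iff₀ (Real.sqrt_pos.2 hk)]
      refine (entropyNumberBalls_le_sqrt hp hn hm k).trans_eq ?_
      rw [div_mul_eq_mul_div, mul_div_assoc, Real.sqrt_div_self', mul_one_div, mul_div_assoc])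
    (fun k hk => by
      refine (div_le_self (entropyNumberBalls_nonneg _ _ _) ?_).trans
        (entropyNumberBalls_le_inv_sq hp hn hm hk)
      exact Real.one_le_sqrt.2 (by linarith [(Nat.cast_nonneg k : (0 : ℝ) ≤ k)]))
  refine hsum.trans ?_
  have hlogK : 1 + log (((n * m) ^ 2 : ℕ) : ℝ) ≤ 2 * X := by
    push_cast
    rw [Real.log_pow, Real.log_mul (by positivity) (by positivity)]
    push_cast
    linarith
  have hA : √((1 + log n) * (c * (n + m))) ≤ √X * (√c * S) := by
    rw [hS, ← Real.sqrt_mul hc0.le, ← Real.sqrt_mul (by linarith)]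
    apply Real.sqrt_le_sqrt
    gcongr <;> linarith
  have hSX : 1 ≤ S * (√X * X) :=
    one_le_mul_of_one_le_of_one_le hS1 (one_le_mul_of_one_le_of_one_le hsX1 hX1)
  rw [hX32]
  calc _ ≤ C₁ * (√X * (√c * S)) * (2 * X) + 2 * 32000 := by gcongr
    _ = 2 * (C₁ * √c) * (S * (√X * X)) + 64000 * 1 := by ring
    _ ≤ 2 * (C₁ * √c) * (S * (√X * X)) + 64000 * (S * (√X * X)) := by gcongr
    _ = _ := by ring
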